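/- arXiv:2012.11166 — 2 statements merged into one kernel-verified Lean document; each statement's English description precedes it below -/
import Mathlib

section
/- Assume q ≥ 3, 1 ≤ s < d ≤ m, 1 ≤ r ≤ m−1, and ms ≥ d(m−r). Then for every F_q-linear subspace U ⊆ F_{q^m} of dimension d, at least a fraction 2/5 of the vectors of Ω lie outside bad(U); that is, 5·|Ω ∖ bad(U)| ≥ 2·|Ω|. -/
open Finset

/-- `Ω`: the set of vectors in `E^k` whose entries are `F`-linearly independent. -/
def OmegaSet (F E : Type*) [Field F] [Field E] [Algebra F E] (k : ℕ) : Set (Fin k → E) :=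
  {x | LinearIndependent F x}

/-- `bad(U)`: the set of `x ∈ Ω` for which there is a not-all-zero tuple `u` with entries in `U`
such that `∑ⱼ uⱼ^{q^ℓ} xⱼ = 0` for all `1 ≤ ℓ ≤ s`. -/
def badSet (F : Type*) {E : Type*} [Field F] [Field E] [Algebra F E]
    (q s k : ℕ) (U : Set E) : Set (Fin k → E) :=
  {x | LinearIndependent F x ∧ ∃ u : Fin k → E, (∀ j, u j ∈ U) ∧ u ≠ 0 ∧
      ∀ ℓ : ℕ, 1 ≤ ℓ → ℓ ≤ s → ∑ j, u j ^ q ^ ℓ * x j = 0}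

/-- The `n`-th iterate of the `q`-power Frobenius is raising to the power `q ^ n`. -/
theorem frobeniusAlgHom_pow_apply {F E : Type*} [Field F] [Fintype F] [Field E] [Algebra F E]
    (n : ℕ) (x : E) :
    (FiniteField.frobeniusAlgHom F E ^ n) x = x ^ Fintype.card F ^ n := by
  induction n with
  | zero => simp
  | succ n ih =>
    rw [pow_succ', AlgHom.mul_apply, ih, FiniteField.frobeniusAlgHom_apply, ← pow_mul, ← pow_succ]

/-- A vector orthogonal to all Frobenius twists of a linearly independent family is zero. -/
theorem eq_zero_of_forall_sum_frobenius_eq_zero {F E ι : Type*} [Field F] [Fintype F] [Field E]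
    [Finite E] [Algebra F E] [Fintype ι] {x u : ι → E} (hx : LinearIndependent F x)
    (h : ∀ n, 1 ≤ n → ∑ j, u j ^ Fintype.card F ^ n * x j = 0) : u = 0 := by
  have h' : ∀ n, ∑ j, u j ^ Fintype.card F ^ n * x j = 0 := by
    intro n
    rcases Nat.eq_zero_or_pos n with rfl | hn
    · have := Fintype.ofFinite E
      simpa [← Module.card_eq_pow_finrank (K := F) (V := E), FiniteField.pow_card] using
        h (Module.finrank F E) Module.finrank_pos
    · exact h n hn
  have key : ∀ c : E, ∀ j, Algebra.trace F E (c * u j) = 0 := by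
    intro c
    refine Fintype.linearIndependent_iff.1 hx _ ?_
    simp_rw [Algebra.smul_def, FiniteField.algebraMap_trace_eq_sum_pow, Finset.sum_mul]
    rw [Finset.sum_comm]
    refine Finset.sum_eq_zero fun n _ => ?_
    simp_rw [mul_pow, mul_assoc, ← Finset.mul_sum, Nat.card_eq_fintype_card, h' n, mul_zero]
  funext j
  refine (traceForm_nondegenerate F E).1 (u j) fun c => ?_
  rw [Algebra.traceForm_apply, mul_comm]
  exact key c j

/-- A finite sequence that is linearly dependent has a term in the span of its predecessors. -/
theorem exists_mem_span_of_not_linearIndependent {K V : Type*} [DivisionRing K] [AddCommGroup V]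
    [Module K V] (v : ℕ → V) (s : ℕ) (h : ¬ LinearIndependent K fun i : Fin s => v i) :
    ∃ t < s, v t ∈ Submodule.span K (Set.range fun i : Fin t => v i) := by
  induction s with
  | zero => exact absurd (linearIndependent_empty_type) h
  | succ s ih =>
    by_cases hs : LinearIndependent K fun i : Fin s => v i
    · refine ⟨s, Nat.lt_succ_self s, ?_⟩
      by_contra hv
      exact h (linearIndependent_finSucc'.2 ⟨by simpa [Fin.init_def] using hs,
        by simpa [Fin.init_def] using hv⟩)
    · obtain ⟨t, ht, hv⟩ := ih hs
      exact ⟨t, ht.trans (Nat.lt_succ_self s), hv⟩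

/-- If the first `s` Frobenius twists of `u` are linearly dependent, then a vector orthogonal to
them is orthogonal to all twists of `u`. -/
theorem sum_frobenius_eq_zero_of_not_linearIndependent {F E ι : Type*} [Field F] [Fintype F]
    [Field E] [Algebra F E] [Fintype ι] {x u : ι → E} {s : ℕ}
    (hdep : ¬ LinearIndependent E fun (i : Fin s) (j : ι) => u j ^ Fintype.card F ^ (i + 1 : ℕ))
    (h : ∀ n, 1 ≤ n → n ≤ s → ∑ j, u j ^ Fintype.card F ^ n * x j = 0) (n : ℕ) (hn : 1 ≤ n) :
    ∑ j, u j ^ Fintype.card F ^ n * x j = 0 := by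
  obtain ⟨t, hts, ht⟩ := exists_mem_span_of_not_linearIndependent
    (fun (i : ℕ) (j : ι) => u j ^ Fintype.card F ^ (i + 1)) s hdep
  obtain ⟨c, hc⟩ := (Submodule.mem_span_range_iff_exists_fun E).1 ht
  induction n using Nat.strong_induction_on with
  | _ n ih =>
    by_cases hns : n ≤ s
    · exact h n hn hns
    obtain ⟨a, rfl⟩ : ∃ a, n = t + 1 + a := ⟨n - (t + 1), by omega⟩
    have hu : ∀ j, u j ^ Fintype.card F ^ (t + 1 + a) =
        ∑ i : Fin t, c i ^ Fintype.card F ^ a * u j ^ Fintype.card F ^ (i + 1 + a : ℕ) := by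
      intro j
      have := congrArg (FiniteField.frobeniusAlgHom F E ^ a) (congrFun hc j)
      simp only [Finset.sum_apply, Pi.smul_apply, smul_eq_mul, map_sum, map_mul,
        frobeniusAlgHom_pow_apply, ← pow_mul, ← pow_add] at this
      exact this.symm
    simp_rw [hu, Finset.sum_mul]
    rw [Finset.sum_comm]
    refine Finset.sum_eq_zero fun i _ => ?_
    simp_rw [mul_assoc, ← Finset.mul_sum]
    rw [ih (i + 1 + a) (by omega) (by omega), mul_zero]

/-- The solution space of `s` independent linear equations in `k` unknowns over a finite field. -/
theorem card_mulVec_eq_zero_mul_pow {K : Type*} [Field K] [Fintype K] {s k : ℕ}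
    (M : Matrix (Fin s) (Fin k) K) (hM : LinearIndependent K M.row) :
    Nat.card {x : Fin k → K // M.mulVec x = 0} * Fintype.card K ^ s = Fintype.card K ^ k := by
  have h1 := LinearMap.finrank_range_add_finrank_ker M.mulVecLin
  have h2 : Module.finrank K (LinearMap.range M.mulVecLin) = s := by
    simpa [Matrix.rank] using hM.rank_matrix
  have h3 : Nat.card {x : Fin k → K // M.mulVec x = 0} =
      Nat.card (LinearMap.ker M.mulVecLin) :=
    Nat.card_congr (Equiv.subtypeEquivRight fun x => by simp)
  rw [h3, Module.natCard_eq_pow_finrank (K := K), Nat.card_eq_fintype_card, ← pow_add]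
  congr 1
  rw [h2, Module.finrank_fin_fun] at h1
  omega

/-- For fixed `u ≠ 0`, the equations defining `bad(U)` have at most `|E| ^ k / |E| ^ s` solutions
with linearly independent entries. -/
theorem card_linearIndependent_sum_frobenius_eq_zero_le {F E : Type*} [Field F] [Fintype F]
    [Field E] [Fintype E] [Algebra F E] {s k : ℕ} {u : Fin k → E} (hu : u ≠ 0) :
    Nat.card {x : Fin k → E // LinearIndependent F x ∧
      ∀ n, 1 ≤ n → n ≤ s → ∑ j, u j ^ Fintype.card F ^ n * x j = 0} * Fintype.card E ^ s ≤
      Fintype.card E ^ k := by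
  by_cases hdep : LinearIndependent E
      fun (i : Fin s) (j : Fin k) => u j ^ Fintype.card F ^ (i + 1 : ℕ)
  · rw [← card_mulVec_eq_zero_mul_pow
      (Matrix.of fun (i : Fin s) (j : Fin k) => u j ^ Fintype.card F ^ (i + 1 : ℕ)) hdep]
    refine Nat.mul_le_mul_right _ (Nat.card_le_card_of_injective
      (Subtype.map id fun x hx => ?_) (Subtype.map_injective _ Function.injective_id))
    funext i
    exact hx.2 (i + 1) (by omega) (by omega)
  · have : IsEmpty {x : Fin k → E // LinearIndependent F x ∧
        ∀ n, 1 ≤ n → n ≤ s → ∑ j, u j ^ Fintype.card F ^ n * x j = 0} := by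
      refine ⟨fun x => hu (eq_zero_of_forall_sum_frobenius_eq_zero x.2.1 ?_)⟩
      exact sum_frobenius_eq_zero_of_not_linearIndependent hdep x.2.2
    simp

/-- The number of bad vectors is at most `|E| ^ k / (q - 1)`. -/
theorem ncard_badSet_mul_le {F E : Type*} [Field F] [Fintype F] [Field E] [Fintype E]
    [Algebra F E] {s k : ℕ} (U : Submodule F E)
    (hU : Module.finrank F U * k ≤ Module.finrank F E * s) :
    (badSet F (Fintype.card F) s k (U : Set E)).ncard * (Fintype.card F - 1) ≤
      Fintype.card E ^ k := by
  classical
  set q := Fintype.card F with hq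
  set r : (Fin k → E) → (Fin k → U) → Prop :=
    fun x u => ∀ n, 1 ≤ n → n ≤ s → ∑ j, (u j : E) ^ q ^ n * x j = 0 with hr
  have hEpos : 0 < Fintype.card E ^ s := pow_pos Fintype.card_pos s
  have hcount := Finset.card_mul_le_card_mul (s := (badSet F q s k (U : Set E)).toFinset)
    (t := ({u | u ≠ 0} : Finset (Fin k → U))) r (m := q - 1)
    (n := Fintype.card E ^ k / Fintype.card E ^ s) ?_ ?_
  · rw [Set.ncard_eq_toFinset_card']
    refine hcount.trans (le_trans (Nat.mul_le_mul_right _ ?_)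
      (Nat.mul_div_le (Fintype.card E ^ k) (Fintype.card E ^ s)))
    refine (Finset.card_le_univ _).trans ?_
    rw [Fintype.card_fun, Fintype.card_fin, Module.card_eq_pow_finrank (K := F) (V := U),
      Module.card_eq_pow_finrank (K := F) (V := E), ← pow_mul, ← pow_mul]
    exact Nat.pow_le_pow_right Fintype.card_pos hU
  · intro x hx
    obtain ⟨-, u, huU, hu0, hu⟩ := Set.mem_toFinset.1 hx
    set v : Fin k → U := fun j => ⟨u j, huU j⟩ with hv
    have hv0 : v ≠ 0 := fun h => hu0 (funext fun j => congrArg Subtype.val (congrFun h j))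
    have hinj : Function.Injective fun c : Fˣ => (c : F) • v :=
      (smul_left_injective F hv0).comp Units.val_injective
    rw [← Fintype.card_units, ← Finset.card_univ, ← Finset.card_image_of_injective _ hinj]
    refine Finset.card_le_card fun w hw => ?_
    obtain ⟨c, -, rfl⟩ := Finset.mem_image.1 hw
    refine (Finset.mem_bipartiteAbove r).2
      ⟨by simpa using hv0, fun n h1 h2 => ?_⟩
    have : ∀ j, (((c : F) • v) j : E) ^ q ^ n * x j = (c : F) • (u j ^ q ^ n * x j) := by
      intro j
      rw [hq, ← frobeniusAlgHom_pow_apply, ← frobeniusAlgHom_pow_apply, Pi.smul_apply,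
        Submodule.coe_smul, map_smul, smul_mul_assoc]
    simp_rw [this, ← Finset.smul_sum, hu n h1 h2, smul_zero]
  · intro u hu
    have hu0 : (fun j => (u j : E)) ≠ 0 := fun h =>
      (Finset.mem_filter.1 hu).2 (funext fun j => Subtype.ext (congrFun h j))
    rw [Nat.le_div_iff_mul_le hEpos]
    refine le_trans (Nat.mul_le_mul_right _ ?_)
      (card_linearIndependent_sum_frobenius_eq_zero_le (F := F) (s := s) hu0)
    rw [Nat.card_eq_fintype_card, Fintype.card_subtype]
    refine Finset.card_le_card fun x hx => ?_
    obtain ⟨hx, hxu⟩ := (Finset.mem_bipartiteBelow r).1 hx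
    exact Finset.mem_filter.2 ⟨Finset.mem_univ x, (Set.mem_toFinset.1 hx).1, hxu⟩

/-- A lower bound for the product counting linearly independent families. -/
theorem pow_mul_le_mul_prod_sub {q Q k : ℕ} (hq : 3 ≤ q) (hk : q ^ k ≤ Q) :
    (Q : ℤ) ^ k * (6 * Q - 3 * q ^ k) ≤ 6 * Q * ∏ i : Fin k, ((Q : ℤ) - q ^ (i : ℕ)) := by
  induction k with
  | zero => simp
  | succ k ih =>
    have hkk : q ^ k ≤ q ^ (k + 1) := Nat.pow_le_pow_right (by omega) (Nat.le_succ k)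
    have hkQ : ((q : ℤ) ^ k) ≤ Q := by exact_mod_cast hkk.trans hk
    rw [Fin.prod_univ_castSucc, ← mul_assoc]
    refine le_trans ?_ (mul_le_mul_of_nonneg_right (ih (hkk.trans hk)) (by simpa using hkQ))
    have hQ : (0 : ℤ) ≤ Q := Int.natCast_nonneg Q
    have hq' : (3 : ℤ) ≤ q := by exact_mod_cast hq
    have ha : (0 : ℤ) ≤ (q : ℤ) ^ k := by positivity
    have key : (Q : ℤ) * (6 * Q - 3 * q ^ (k + 1)) ≤ (6 * Q - 3 * q ^ k) * (Q - q ^ k) := by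
      rw [pow_succ (q : ℤ) k]
      nlinarith [mul_nonneg (mul_nonneg ha hQ) (sub_nonneg.2 hq'), mul_nonneg ha ha]
    rw [pow_succ (Q : ℤ) k, mul_assoc, mul_assoc]
    exact mul_le_mul_of_nonneg_left (by simpa using key) (by positivity)

/-- At least `5/6` of all vectors of length `k < [E : F]` have linearly independent entries. -/
theorem five_mul_pow_le_six_mul_ncard_omegaSet {F E : Type*} [Field F] [Fintype F] [Field E]
    [Fintype E] [Algebra F E] {k : ℕ} (hq : 3 ≤ Fintype.card F) (hk : k < Module.finrank F E) :
    5 * Fintype.card E ^ k ≤ 6 * (OmegaSet F E k).ncard := by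
  have hQ : Fintype.card E = Fintype.card F ^ Module.finrank F E := Module.card_eq_pow_finrank
  have hcard : (OmegaSet F E k).ncard =
      ∏ i : Fin k, (Fintype.card E - Fintype.card F ^ (i : ℕ)) := by
    rw [hQ]
    exact card_linearIndependent hk.le
  have hle : ∀ i, i ≤ Module.finrank F E → Fintype.card F ^ i ≤ Fintype.card E := fun i hi =>
    hQ ▸ Nat.pow_le_pow_right (by omega) hi
  have h := pow_mul_le_mul_prod_sub hq (hle k hk.le)
  have hprod : ((OmegaSet F E k).ncard : ℤ) =
      ∏ i : Fin k, ((Fintype.card E : ℤ) - Fintype.card F ^ (i : ℕ)) := by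
    rw [hcard, Nat.cast_prod]
    refine Finset.prod_congr rfl fun i _ => ?_
    rw [Nat.cast_sub (hle i (by omega)), Nat.cast_pow]
  rw [← hprod] at h
  have h3 : 3 * (Fintype.card F : ℤ) ^ k ≤ Fintype.card E := by
    have := hle (k + 1) hk
    rw [pow_succ'] at this
    exact_mod_cast (Nat.mul_le_mul_right _ hq).trans this
  have hpos : (0 : ℤ) < Fintype.card E := by exact_mod_cast Fintype.card_pos
  have hfin : (5 * (Fintype.card E : ℤ) ^ k) * Fintype.card E ≤
      (6 * (OmegaSet F E k).ncard) * Fintype.card E := by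
    have := mul_le_mul_of_nonneg_left (a := (Fintype.card E : ℤ) ^ k)
      (show 5 * (Fintype.card E : ℤ) ≤ 6 * Fintype.card E - 3 * Fintype.card F ^ k by linarith)
      (by positivity)
    linarith
  exact_mod_cast le_of_mul_le_mul_right hfin hpos

/-- If `q ≥ 3`, `1 ≤ s < d ≤ m`, `1 ≤ r ≤ m - 1`, and `ms ≥ d(m-r)`, then for
every `F_q`-subspace `U ⊆ F_{q^m}` of dimension `d`, at least a fraction `2/5` of the vectors
of `Ω` lie outside `bad(U)`: `5·|Ω \ bad(U)| ≥ 2·|Ω|`. -/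
theorem stmt_6 {F E : Type*} [Field F] [Fintype F] [Field E] [Fintype E] [Algebra F E]
    (q m s d r : ℕ) (hq : Fintype.card F = q) (hm : Module.finrank F E = m)
    (hq3 : 3 ≤ q) (hs1 : 1 ≤ s) (hsd : s < d) (hdm : d ≤ m)
    (hr1 : 1 ≤ r) (hrm : r ≤ m - 1) (hms : d * (m - r) ≤ m * s)
    (U : Submodule F E) (hU : Module.finrank F U = d) :
    2 * (OmegaSet F E (m - r)).ncard ≤
      5 * (OmegaSet F E (m - r) \ badSet F q s (m - r) (U : Set E)).ncard := by
  subst hq hm hU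
  have hbad := ncard_badSet_mul_le (s := s) (k := Module.finrank F E - r) U hms
  have hOmega := five_mul_pow_le_six_mul_ncard_omegaSet (F := F) (E := E)
    (k := Module.finrank F E - r) hq3 (by omega)
  have hdiff := Set.le_ncard_sdiff (badSet F (Fintype.card F) s (Module.finrank F E - r) (U : Set E))
    (OmegaSet F E (Module.finrank F E - r))
  have h2 := (Nat.mul_le_mul_left _ (show 2 ≤ Fintype.card F - 1 by omega)).trans hbad
  omega
end

section
/- Assume q = 2, 1 ≤ s < d ≤ m, 1 ≤ r ≤ m, ms = d(m−r), let a = gcd(m,d), and let U ⊆ F_{2^m} be an F_{2^a}-linear subspace of F_{2^a}-dimension d/a. Then there exists an F_2-linear subspace V ⊆ F_{2^m} of dimension r such that the pair (U,V) is good. -/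
open Finset

/-- The trace-dual of an `F`-subspace `V` of `E`, where `Tr(x) = ∑_{i<m} x^{q^i}`:
`V^⊥ = {x : ∀ v ∈ V, Tr(v*x) = 0}`. -/
def traceDual {F E : Type*} [Field F] [Fintype F] [Field E] [Fintype E] [Algebra F E]
    (q m : ℕ) (hq : Fintype.card F = q) (V : Submodule F E) : Submodule F E where
  carrier := {x : E | ∀ v ∈ V, ∑ i ∈ Finset.range m, (v * x) ^ q ^ i = 0}
  zero_mem' := by
    intro v hv
    have hq0 : q ≠ 0 := by
      have h1 : 0 < Fintype.card F := Fintype.card_pos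
      omega
    refine Finset.sum_eq_zero fun i _ => ?_
    rw [mul_zero, zero_pow (pow_ne_zero i hq0)]
  add_mem' := by
    intro x y hx hy v hv
    obtain ⟨n, hp, hcard⟩ := FiniteField.card F (ringChar F)
    haveI : Fact (Nat.Prime (ringChar F)) := ⟨hp⟩
    haveI : CharP E (ringChar F) :=
      charP_of_injective_algebraMap (algebraMap F E).injective (ringChar F)
    have hq' : q = ringChar F ^ (n : ℕ) := by rw [← hq, hcard]
    have key : ∀ a b : E, ∀ i : ℕ, (a + b) ^ q ^ i = a ^ q ^ i + b ^ q ^ i := by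
      intro a b i
      rw [hq', ← pow_mul]
      exact add_pow_char_pow a b (ringChar F) ((n : ℕ) * i)
    calc ∑ i ∈ Finset.range m, (v * (x + y)) ^ q ^ i
        = ∑ i ∈ Finset.range m, ((v * x) ^ q ^ i + (v * y) ^ q ^ i) := by
          refine Finset.sum_congr rfl fun i _ => ?_
          rw [mul_add, key]
      _ = 0 := by rw [Finset.sum_add_distrib, hx v hv, hy v hv, add_zero]
  smul_mem' := by
    intro c x hx v hv
    have hc : ∀ i : ℕ, (algebraMap F E c) ^ q ^ i = algebraMap F E c := by
      intro i
      rw [← map_pow]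
      congr 1
      calc c ^ q ^ i = c ^ Fintype.card F ^ i := by rw [hq]
        _ = c := FiniteField.pow_card_pow i c
    calc ∑ i ∈ Finset.range m, (v * (c • x)) ^ q ^ i
        = ∑ i ∈ Finset.range m, algebraMap F E c * (v * x) ^ q ^ i := by
          refine Finset.sum_congr rfl fun i _ => ?_
          rw [Algebra.smul_def, mul_left_comm, mul_pow, hc]
      _ = algebraMap F E c * ∑ i ∈ Finset.range m, (v * x) ^ q ^ i := (Finset.mul_sum _ _ _).symm
      _ = 0 := by rw [hx v hv, mul_zero]

/-- A pair `(U, V)` of `F`-subspaces of `E` is *good* (for the parameter `s`) if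
`m·s ≥ dim U · (m - dim V)` and for every `F`-basis `u₁, …, u_{dim U}` of `U` and all
`v'ᵢ ∈ V^⊥`: if `∑ᵢ v'ᵢ · uᵢ^{q^ℓ} = 0` for every `1 ≤ ℓ ≤ s`, then all `v'ᵢ = 0`. -/
def IsGoodPair {F E : Type*} [Field F] [Fintype F] [Field E] [Fintype E] [Algebra F E]
    (q m s : ℕ) (hq : Fintype.card F = q) (U V : Submodule F E) : Prop :=
  m * s ≥ Module.finrank F U * (m - Module.finrank F V) ∧
  ∀ u : Fin (Module.finrank F U) → E,
    (∀ i, u i ∈ U) → LinearIndependent F u → Submodule.span F (Set.range u) = U →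
  ∀ v' : Fin (Module.finrank F U) → E,
    (∀ i, v' i ∈ traceDual q m hq V) →
    (∀ ℓ : ℕ, 1 ≤ ℓ → ℓ ≤ s → ∑ i, v' i * u i ^ q ^ ℓ = 0) →
    ∀ i, v' i = 0

/-- The `E`-linear map `w ↦ (∑ₖ wₖ cₖ^{q^ℓ})` for `1 ≤ ℓ ≤ s`, where `q = |F|`. -/
def mooreMap (F : Type*) {E : Type*} [Fintype F] [Field E] {n : ℕ} (s : ℕ) (c : Fin n → E) :
    (Fin n → E) →ₗ[E] (Fin s → E) :=
  Matrix.vecMulLinear (Matrix.of fun k (ℓ : Fin s) => c k ^ Fintype.card F ^ (ℓ.1 + 1))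

theorem mooreMap_apply (F : Type*) {E : Type*} [Fintype F] [Field E] {n s : ℕ}
    (c w : Fin n → E) (ℓ : Fin s) :
    mooreMap F s c w ℓ = ∑ k, w k * c k ^ Fintype.card F ^ (ℓ.1 + 1) := rfl

section Moore

theorem pow_card_pow_eq_frobeniusAlgHom_pow {F E : Type*} [Field F] [Fintype F] [Field E]
    [Algebra F E] (x : E) (ℓ : ℕ) :
    x ^ Fintype.card F ^ ℓ = ((FiniteField.frobeniusAlgHom F E) ^ ℓ) x := by
  rw [AlgHom.coe_pow, FiniteField.coe_frobeniusAlgHom, pow_iterate]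

theorem sum_mul_sum_smul_pow_card_pow {F E ι κ : Type*} [Field F] [Fintype F] [Field E]
    [Algebra F E] [Fintype ι] [Fintype κ]
    (a : ι → κ → F) (u : ι → E) (w : κ → E) (ℓ : ℕ) :
    ∑ k, w k * (∑ i, a i k • u i) ^ Fintype.card F ^ ℓ =
      ∑ i, (∑ k, a i k • w k) * u i ^ Fintype.card F ^ ℓ := by
  simp only [pow_card_pow_eq_frobeniusAlgHom_pow, map_sum, map_smul, Finset.mul_sum, Finset.sum_mul]
  rw [Finset.sum_comm]
  simp only [mul_smul_comm, smul_mul_assoc]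

theorem linearized_eq_zero_of_mem_span {F E ι κ : Type*} [Field F] [Fintype F] [Field E]
    [Algebra F E] [Fintype ι] [Fintype κ] {c : κ → E} {e : κ → ℕ} {b : ι → E}
    (h : ∀ j, ∑ ℓ, c ℓ * b j ^ Fintype.card F ^ e ℓ = 0) {x : E}
    (hx : x ∈ Submodule.span F (Set.range b)) : ∑ ℓ, c ℓ * x ^ Fintype.card F ^ e ℓ = 0 := by
  obtain ⟨a, rfl⟩ := (Submodule.mem_span_range_iff_exists_fun F).mp hx
  simp only [pow_card_pow_eq_frobeniusAlgHom_pow, map_sum, map_smul, Finset.mul_sum,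
    mul_smul_comm] at h ⊢
  rw [Finset.sum_comm]
  simp only [← Finset.smul_sum, h, smul_zero, Finset.sum_const_zero]

variable {F E : Type*} [Field F] [Fintype F] [Field E] [Fintype E] [Algebra F E]

/-- A nonzero linearized polynomial with `s` coefficients has fewer than `q ^ s` roots. -/
theorem finrank_lt_of_linearized_eq_zero {s : ℕ} {c : Fin s → E} (hc : c ≠ 0)
    (S : Submodule F E)
    (h : ∀ x ∈ S, ∑ ℓ, c ℓ * x ^ Fintype.card F ^ (ℓ.1 + 1) = 0) :
    Module.finrank F S < s := by
  classical
  set q := Fintype.card F with hq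
  have hq1 : 1 < q := Fintype.one_lt_card
  obtain ⟨j, hj⟩ := Function.ne_iff.mp hc
  have hs : 0 < s := j.pos
  let p : Polynomial E := ∑ ℓ : Fin s, Polynomial.C (c ℓ) * Polynomial.X ^ q ^ ℓ.1
  have hp : p ≠ 0 := by
    intro h0
    apply hj
    have : p.coeff (q ^ j.1) = c j := by
      simp only [p, Polynomial.finsetSum_coeff, Polynomial.coeff_C_mul_X_pow]
      rw [Finset.sum_eq_single j]
      · simp
      · intro b _ hb
        rw [if_neg]
        intro heq
        exact hb (Fin.ext (Nat.pow_right_injective hq1 heq.symm))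
      · simp
    rw [← this, h0, Polynomial.coeff_zero, Pi.zero_apply]
  have hdeg : p.natDegree ≤ q ^ (s - 1) := by
    refine Polynomial.natDegree_sum_le_of_forall_le _ _ fun ℓ _ => ?_
    exact (Polynomial.natDegree_C_mul_X_pow_le _ _).trans
      (Nat.pow_le_pow_right hq1.le (by omega))
  have hinj : Function.Injective fun x : E => x ^ q := by
    have := (FiniteField.frobeniusAlgHom F E).toRingHom.injective
    simpa [Function.Injective] using this
  have hsub : (Finset.univ.filter (· ∈ S)).image (fun x : E => x ^ q) ⊆ p.roots.toFinset := by
    intro y hy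
    obtain ⟨x, hx, rfl⟩ := Finset.mem_image.mp hy
    rw [Multiset.mem_toFinset, Polynomial.mem_roots hp, Polynomial.IsRoot,
      ← h x (by simpa using hx)]
    simp only [p, Polynomial.eval_finsetSum, Polynomial.eval_mul, Polynomial.eval_C,
      Polynomial.eval_pow, Polynomial.eval_X]
    refine Finset.sum_congr rfl fun ℓ _ => ?_
    rw [← pow_mul, pow_succ']
  have hle := (Finset.card_le_card hsub).trans
    ((Multiset.toFinset_card_le _).trans ((Polynomial.card_roots' p).trans hdeg))
  rw [Finset.card_image_of_injective _ hinj, ← Fintype.card_subtype,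
    Module.card_eq_pow_finrank (K := F) (V := S), ← hq] at hle
  have := (Nat.pow_le_pow_iff_right hq1).mp hle
  omega

/-- Moore matrices of linearly independent families have full rank. -/
theorem eq_zero_of_sum_mul_pow_card_pow_eq_zero {ρ s : ℕ} (hρ : ρ ≤ s) {b : Fin ρ → E}
    (hb : LinearIndependent F b) {y : Fin ρ → E}
    (h : ∀ ℓ : Fin s, ∑ j, y j * b j ^ Fintype.card F ^ (ℓ.1 + 1) = 0) : y = 0 := by
  by_contra hy
  let A : Matrix (Fin ρ) (Fin ρ) E := fun j ℓ => b j ^ Fintype.card F ^ (ℓ.1 + 1)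
  have hdet : A.det = 0 := by
    refine Matrix.exists_vecMul_eq_zero_iff.mp ⟨y, hy, ?_⟩
    ext ℓ
    exact h (ℓ.castLE hρ)
  obtain ⟨c, hc, hA⟩ := Matrix.exists_mulVec_eq_zero_iff.mpr hdet
  have := finrank_lt_of_linearized_eq_zero hc (Submodule.span F (Set.range b)) fun x hx =>
    linearized_eq_zero_of_mem_span (fun j => by
      refine Eq.trans ?_ (congrFun hA j)
      exact Finset.sum_congr rfl fun ℓ _ => mul_comm _ _) hx
  rw [finrank_span_eq_card hb, Fintype.card_fin] at this
  exact this.false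

theorem mooreMap_surjective {n s : ℕ} {c w : Fin n → E} (hw : LinearIndependent F w)
    (hc : c ≠ 0) (h : mooreMap F s c w = 0) : Function.Surjective (mooreMap F s c) := by
  classical
  by_contra hsurj
  obtain ⟨f, hf, hker⟩ := Submodule.exists_le_ker_of_lt_top (LinearMap.range (mooreMap F s c))
    (lt_top_iff_ne_top.mpr (mt LinearMap.range_eq_top.mp hsurj))
  let lam : Fin s → E := fun ℓ => f (Pi.single ℓ 1)
  have hflam (x : Fin s → E) : f x = ∑ ℓ, lam ℓ * x ℓ := by
    conv_lhs => rw [pi_eq_sum_univ' x, map_sum]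
    refine Finset.sum_congr rfl fun ℓ _ => ?_
    rw [map_smul, smul_eq_mul, mul_comm]
  have hlam : lam ≠ 0 := by
    intro h0
    apply hf
    ext x
    simp [lam, funext_iff] at h0
    simp [h0]
  have hroot (k : Fin n) : ∑ ℓ, lam ℓ * c k ^ Fintype.card F ^ (ℓ.1 + 1) = 0 := by
    have := hker (LinearMap.mem_range_self (mooreMap F s c) (Pi.single k 1))
    rw [LinearMap.mem_ker, hflam] at this
    simpa [mooreMap_apply, Pi.single_apply] using this
  let S := Submodule.span F (Set.range c)
  have hS : Module.finrank F S < s :=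
    finrank_lt_of_linearized_eq_zero hlam S fun x hx => linearized_eq_zero_of_mem_span hroot hx
  let b := Module.finBasis F S
  have hcS (k) : c k ∈ S := Submodule.subset_span ⟨k, rfl⟩
  let a (j : Fin (Module.finrank F S)) (k : Fin n) : F := b.repr ⟨c k, hcS k⟩ j
  have hca (k) : c k = ∑ j, a j k • (b j : E) := by
    have := congrArg Subtype.val (b.sum_repr ⟨c k, hcS k⟩)
    rw [Submodule.coe_sum] at this
    exact this.symm
  have hy := eq_zero_of_sum_mul_pow_card_pow_eq_zero (F := F) hS.le
    (b := fun j => (b j : E)) (b.linearIndependent.map' S.subtype S.ker_subtype)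
    (y := fun j => ∑ k, a j k • w k) (fun ℓ => by
      rw [← sum_mul_sum_smul_pow_card_pow]
      simp only [← hca]
      exact congrFun h ℓ)
  apply hc
  ext k
  rw [hca]
  refine Finset.sum_eq_zero fun j _ => ?_
  rw [Fintype.linearIndependent_iff.mp hw (fun k => a j k) (congrFun hy j) k, zero_smul]

theorem card_pow_le_two_mul_card_linearIndependent {n : ℕ} (hn : n < Module.finrank F E) :
    Fintype.card E ^ n ≤ 2 * Nat.card {w : Fin n → E // LinearIndependent F w} := by
  rw [card_linearIndependent hn.le, Module.card_eq_pow_finrank (K := F) (V := E),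
    Fin.prod_univ_eq_prod_range
      (fun i => Fintype.card F ^ Module.finrank F E - Fintype.card F ^ i)]
  have hq : 2 ≤ Fintype.card F := Fintype.one_lt_card
  have hqn : 2 * Fintype.card F ^ n ≤ Fintype.card F ^ Module.finrank F E :=
    calc 2 * Fintype.card F ^ n ≤ Fintype.card F ^ (n + 1) := by rw [pow_succ']; gcongr
      _ ≤ _ := Nat.pow_le_pow_right (by omega) hn
  have hlt (k : ℕ) (hk : k ≤ n) : Fintype.card F ^ k ≤ Fintype.card F ^ Module.finrank F E :=
    Nat.pow_le_pow_right (by omega) (by omega)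
  generalize Fintype.card F = q at *
  generalize q ^ Module.finrank F E = Q at *
  have key (k : ℕ) (hk : k ≤ n) :
      Q ^ k * Q ≤ (∏ i ∈ Finset.range k, (Q - q ^ i)) * Q + q ^ k * Q ^ k := by
    induction k with
    | zero => simp
    | succ k ih =>
      have hprod : ∏ i ∈ Finset.range k, (Q - q ^ i) ≤ Q ^ k := by
        simpa using Finset.prod_le_pow_card (Finset.range k) (fun i => Q - q ^ i) Q
          fun i _ => Nat.sub_le _ _
      have ih := ih (by omega)
      have hQ := hlt k (by omega)
      rw [Finset.prod_range_succ]
      obtain ⟨R, rfl⟩ := Nat.exists_eq_add_of_le hQ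
      rw [Nat.add_sub_cancel_left]
      generalize ∏ i ∈ Finset.range k, (q ^ k + R - q ^ i) = P at *
      generalize hT : (q ^ k + R) ^ k = T at *
      rw [pow_succ (q ^ k + R), hT, pow_succ q]
      generalize q ^ k = x at *
      calc T * (x + R) * (x + R) ≤ (P * (x + R) + x * T) * (x + R) := by gcongr
        _ = P * R * (x + R) + (P * x + x * T) * (x + R) := by ring
        _ ≤ P * R * (x + R) + (T * x + x * T) * (x + R) := by gcongr
        _ = P * R * (x + R) + x * 2 * (T * (x + R)) := by ring
        _ ≤ P * R * (x + R) + x * q * (T * (x + R)) := by gcongr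
  have hkey := key n le_rfl
  have hQ : 0 < Q := lt_of_lt_of_le (by positivity) hqn
  refine Nat.le_of_mul_le_mul_right ?_ hQ
  nlinarith [Nat.mul_le_mul_right (Q ^ n) hqn]

/-- For an `Fa`-subspace `U` with `|U| ^ n = |E| ^ s`, a counting argument provides linearly
independent `w₁, …, wₙ` for which the square system `∑ₖ wₖ cₖ^{q^ℓ} = 0` (`1 ≤ ℓ ≤ s`) has no
nonzero solution `c` in `U`. -/
theorem exists_linearIndependent_forall_mooreMap_eq_zero {Fa : Type*} [Field Fa] [Fintype Fa]
    [Algebra Fa E] (hFa : 3 ≤ Fintype.card Fa) (U : Submodule Fa E) {n s : ℕ}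
    (hn : n < Module.finrank F E) (hcard : Nat.card U ^ n = Fintype.card E ^ s) :
    ∃ w : Fin n → E, LinearIndependent F w ∧
      ∀ c : Fin n → E, (∀ k, c k ∈ U) → mooreMap F s c w = 0 → c = 0 := by
  classical
  by_contra! hbad
  rw [Nat.card_eq_fintype_card] at hcard
  have hE : 1 < Fintype.card E := Fintype.one_lt_card
  have hsn : s ≤ n := by
    refine (Nat.pow_le_pow_iff_right hE).mp (hcard ▸ ?_)
    exact Nat.pow_le_pow_left (Fintype.card_subtype_le _) n
  let G := Finset.univ.filter fun w : Fin n → E => LinearIndependent F w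
  let C := Finset.univ.filter fun c : Fin n → U => c ≠ 0
  let val (c : Fin n → U) : Fin n → E := fun k => c k
  have hval (c : Fin n → U) (hc : c ≠ 0) : val c ≠ 0 := fun h =>
    hc (funext fun k => Subtype.ext (congrFun h k))
  have hC : #C < Fintype.card E ^ s := by
    have : #C < Fintype.card (Fin n → U) :=
      Finset.card_lt_univ_of_notMem (x := 0) (by simp [C])
    rwa [Fintype.card_fun, Fintype.card_fin, hcard] at this
  have hG : Fintype.card E ^ n ≤ 2 * #G := by
    have := card_pow_le_two_mul_card_linearIndependent (E := E) hn
    rwa [Nat.card_eq_fintype_card, Fintype.card_subtype] at this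
  have hcount := Finset.card_mul_le_card_mul (s := G) (t := C)
    (fun w c => mooreMap F s (val c) w = 0) (m := 2) (n := Fintype.card E ^ (n - s)) ?_ ?_
  · have : #C * Fintype.card E ^ (n - s) < Fintype.card E ^ n := by
      calc _ < Fintype.card E ^ s * Fintype.card E ^ (n - s) := by gcongr
        _ = _ := by rw [← pow_add]; congr 1; omega
    omega
  · intro w hw
    obtain ⟨c, hcU, hcw, hc0⟩ := hbad w (by simpa [G] using hw)
    have hc' : (fun k => (⟨c k, hcU k⟩ : U)) ≠ 0 := fun h =>
      hc0 (funext fun k => congrArg Subtype.val (congrFun h k))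
    let f (x : Fa) : Fin n → U := x • fun k => (⟨c k, hcU k⟩ : U)
    have hf : Function.Injective f := smul_left_injective Fa hc'
    calc 2 ≤ #(Finset.univ.erase (0 : Fa)) := by
          rw [Finset.card_erase_of_mem (Finset.mem_univ _), Finset.card_univ]; omega
      _ = #((Finset.univ.erase (0 : Fa)).image f) := (Finset.card_image_of_injective _ hf).symm
      _ ≤ _ := by
        refine Finset.card_le_card fun y hy => ?_
        obtain ⟨x, hx, rfl⟩ := Finset.mem_image.mp hy
        rw [Finset.mem_bipartiteAbove]
        refine ⟨by simpa [C, f] using ⟨Finset.ne_of_mem_erase hx, hc'⟩, ?_⟩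
        ext ℓ
        have := congrFun hcw ℓ
        simp only [mooreMap_apply, Pi.zero_apply, val, f, Pi.smul_apply, Submodule.coe_smul,
          smul_pow, mul_smul_comm, ← Finset.smul_sum] at this ⊢
        rw [this, smul_zero]
  · intro c hc
    by_cases hex : ∃ w ∈ G, mooreMap F s (val c) w = 0
    · obtain ⟨w, hw, hcw⟩ := hex
      have hsurj := mooreMap_surjective (by simpa [G] using hw)
        (hval c (by simpa [C] using hc)) hcw
      have hrank := LinearMap.finrank_range_add_finrank_ker (mooreMap F s (val c))
      rw [LinearMap.range_eq_top.mpr hsurj, finrank_top, Module.finrank_fin_fun,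
        Module.finrank_fin_fun] at hrank
      have hker : Fintype.card (LinearMap.ker (mooreMap F s (val c))) =
          Fintype.card E ^ (n - s) := by
        rw [Module.card_eq_pow_finrank (K := E)]
        congr 1
        omega
      rw [← hker, Fintype.card_subtype]
      refine Finset.card_le_card fun w hw => ?_
      simpa using (Finset.mem_bipartiteBelow _ |>.mp hw).2
    · refine le_of_eq_of_le (Finset.card_eq_zero.mpr ?_) (Nat.zero_le _)
      rw [Finset.eq_empty_iff_forall_notMem]
      intro w hw
      exact hex ⟨w, Finset.mem_bipartiteBelow _ |>.mp hw⟩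

theorem traceDual_eq_orthogonal {q m : ℕ} (hq : Fintype.card F = q)
    (hm : Module.finrank F E = m) (V : Submodule F E) :
    traceDual q m hq V = (Algebra.traceForm F E).orthogonal V := by
  subst hq hm
  ext x
  refine forall₂_congr fun v _ => ?_
  rw [← Nat.card_eq_fintype_card, ← FiniteField.algebraMap_trace_eq_sum_pow,
    map_eq_zero_iff _ (algebraMap F E).injective]
  rfl

end Moore

/-- If `q = 2`, `1 ≤ s < d ≤ m`, `1 ≤ r ≤ m`, `ms = d(m-r)`, `a = gcd(m, d)`,
and `U ⊆ F_{2^m}` is an `F_{2^a}`-subspace of `F_{2^a}`-dimension `d/a`, then there exists an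
`F_2`-subspace `V ⊆ F_{2^m}` of dimension `r` such that `(U, V)` is a good pair. -/
theorem stmt_11 {F Fa E : Type*} [Field F] [Fintype F] [Field Fa] [Fintype Fa]
    [Field E] [Fintype E] [Algebra F Fa] [Algebra Fa E] [Algebra F E] [IsScalarTower F Fa E]
    (q m s d r a : ℕ) (hq : Fintype.card F = q) (hq2 : q = 2) (hm : Module.finrank F E = m)
    (hs1 : 1 ≤ s) (hsd : s < d) (hdm : d ≤ m) (hr1 : 1 ≤ r) (hrm : r ≤ m)
    (hms : m * s = d * (m - r))
    (ha : a = Nat.gcd m d) (hqa : Fintype.card Fa = q ^ a)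
    (U : Submodule Fa E) (hUa : Module.finrank Fa U = d / a)
    (hUd : Module.finrank F (U.restrictScalars F) = d) :
    ∃ V : Submodule F E, Module.finrank F V = r ∧
      IsGoodPair q m s hq (U.restrictScalars F) V := by
  obtain ⟨n, rfl⟩ : ∃ n, r + n = m := ⟨m - r, by omega⟩
  rw [Nat.add_sub_cancel_left] at hms
  have ha2 : 2 ≤ a := by
    by_contra! h
    have ha0 : 0 < a := ha ▸ Nat.gcd_pos_of_pos_left d (by omega)
    have hcop : Nat.Coprime d (r + n) := by rw [Nat.coprime_comm, Nat.Coprime]; omega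
    exact absurd (Nat.le_of_dvd hs1 (hcop.dvd_of_dvd_mul_left ⟨n, hms⟩)) (by omega)
  have hFa : 3 ≤ Fintype.card Fa := by
    rw [hqa, hq2]
    calc 3 ≤ 2 ^ 2 := by norm_num
      _ ≤ 2 ^ a := Nat.pow_le_pow_right (by norm_num) ha2
  have hcard : Nat.card U ^ n = Fintype.card E ^ s := by
    have hU : Nat.card U = Nat.card F ^ d := by
      rw [← hUd]
      exact Module.natCard_eq_pow_finrank (K := F) (V := U.restrictScalars F)
    rw [hU, Module.card_eq_pow_finrank (K := F) (V := E), hm, Nat.card_eq_fintype_card,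
      ← pow_mul, ← pow_mul, hms]
  obtain ⟨w, hw, hgood⟩ := exists_linearIndependent_forall_mooreMap_eq_zero (F := F) hFa U
    (n := n) (s := s) (by omega) hcard
  let W := Submodule.span F (Set.range w)
  have hW : Module.finrank F W = n := by
    rw [finrank_span_eq_card hw, Fintype.card_fin]
  have hnd := traceForm_nondegenerate F E
  have hrefl := (Algebra.traceForm_isSymm F (S := E)).isRefl
  refine ⟨(Algebra.traceForm F E).orthogonal W, ?_, ?_, ?_⟩
  · rw [LinearMap.BilinForm.finrank_orthogonal hnd, hm, hW, Nat.add_sub_cancel]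
  · rw [LinearMap.BilinForm.finrank_orthogonal hnd, hm, hW, hUd, hms, Nat.add_sub_cancel,
      Nat.add_sub_cancel_left]
  · intro u huU hu _ v hv hsum
    rw [traceDual_eq_orthogonal hq hm,
      LinearMap.BilinForm.orthogonal_orthogonal hnd hrefl] at hv
    choose A hA using fun i => (Submodule.mem_span_range_iff_exists_fun F).mp (hv i)
    have hc := hgood (fun k => ∑ i, A i k • u i)
      (fun k => (U.restrictScalars F).sum_mem fun i _ => Submodule.smul_mem _ _ (huU i)) (by
        ext ℓ
        rw [mooreMap_apply, sum_mul_sum_smul_pow_card_pow]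
        simp only [hA, hq]
        exact hsum _ (by omega) (by omega))
    intro i
    rw [← hA]
    refine Finset.sum_eq_zero fun k _ => ?_
    rw [Fintype.linearIndependent_iff.mp hu (fun i => A i k) (congrFun hc k) i, zero_smul]
end
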